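/- arXiv:0911.3570 — 2 statements merged into one kernel-verified Lean document; each statement's English description precedes it below -/
import Mathlib

section
/- Let A be a finite-dimensional power-commutative real division algebra and e an omnipresent idempotent of A, with left multiplication map L_e. Then the isotope A_{L_e⁻¹}, with multiplication x ∘ y = (L_e⁻¹ x)·(L_e⁻¹ y), is a quadratic division algebra with identity element e. -/
open Module

section Defs

variable {A : Type*} [AddCommGroup A] [Module ℝ A]

/-- A linear subspace closed under the multiplication `m`. -/
def IsSubalg (m : A →ₗ[ℝ] A →ₗ[ℝ] A) (U : Submodule ℝ A) : Prop :=
  ∀ x ∈ U, ∀ y ∈ U, m x y ∈ U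

/-- The subalgebra generated by a set `s`: the smallest subspace containing `s`
and closed under multiplication. -/
def genSubalg (m : A →ₗ[ℝ] A →ₗ[ℝ] A) (s : Set A) : Submodule ℝ A :=
  sInf {U : Submodule ℝ A | IsSubalg m U ∧ s ⊆ (U : Set A)}

/-- `m` is a division-algebra multiplication: for nonzero `a`, both left and
right multiplication by `a` are bijective. -/
def IsDivision (m : A →ₗ[ℝ] A →ₗ[ℝ] A) : Prop :=
  ∀ a : A, a ≠ 0 →
    Function.Bijective (fun x : A => m a x) ∧ Function.Bijective (fun x : A => m x a)

/-- Power-commutativity: every subalgebra generated by a single element is commutative. -/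
def PowerComm (m : A →ₗ[ℝ] A →ₗ[ℝ] A) : Prop :=
  ∀ x : A, ∀ a ∈ genSubalg m {x}, ∀ b ∈ genSubalg m {x}, m a b = m b a

/-- An omnipresent idempotent: a nonzero idempotent contained in every
two-dimensional subalgebra. -/
def Omnipresent (m : A →ₗ[ℝ] A →ₗ[ℝ] A) (e : A) : Prop :=
  e ≠ 0 ∧ m e e = e ∧
    ∀ U : Submodule ℝ A, IsSubalg m U → Module.finrank ℝ U = 2 → e ∈ U

/-- `one` is an identity element for `m` and for every `x` the elements
`one, x, x²` are linearly dependent. -/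
def IsQuadraticWith (m : A →ₗ[ℝ] A →ₗ[ℝ] A) (one : A) : Prop :=
  (∀ x : A, m one x = x ∧ m x one = x) ∧
    ∀ x : A, ¬ LinearIndependent ℝ ![one, x, m x x]

/-- A quadratic algebra: unital, and `1, x, x²` linearly dependent for all `x`. -/
def IsQuadratic (m : A →ₗ[ℝ] A →ₗ[ℝ] A) : Prop :=
  ∃ one : A, IsQuadraticWith m one

/-- The isotope multiplication `x ∘ y = (T x)·(T y)`. -/
def isotope (m : A →ₗ[ℝ] A →ₗ[ℝ] A) (T : A →ₗ[ℝ] A) : A →ₗ[ℝ] A →ₗ[ℝ] A :=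
  (m.compl₂ T).comp T

/-- A planar map on a quadratic division algebra with identity `one`:
invertible, fixes `one`, and leaves every subalgebra invariant. -/
def Planar (m : A →ₗ[ℝ] A →ₗ[ℝ] A) (one : A) (T : A →ₗ[ℝ] A) : Prop :=
  Function.Bijective T ∧ T one = one ∧
    ∀ U : Submodule ℝ A, IsSubalg m U → ∀ x ∈ U, T x ∈ U

/-- The imaginary space `Im B = {x ∉ ℝ·1 : x² ∈ ℝ·1} ∪ {0}` of a quadratic algebra. -/
def ImSet (m : A →ₗ[ℝ] A →ₗ[ℝ] A) (one : A) : Set A :=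
  {x : A | x ∉ Submodule.span ℝ {one} ∧ m x x ∈ Submodule.span ℝ {one}} ∪ {0}

/-- The centraliser `C(e) = {y : e·y = y·e}`, a linear subspace. -/
def centraliser (m : A →ₗ[ℝ] A →ₗ[ℝ] A) (e : A) : Submodule ℝ A :=
  LinearMap.ker (m e - m.flip e)

/-- An exceptional idempotent of a four-dimensional algebra: its centraliser is
three-dimensional and closed under squaring. -/
def Exceptional (m : A →ₗ[ℝ] A →ₗ[ℝ] A) (e : A) : Prop :=
  Module.finrank ℝ (centraliser m e) = 3 ∧
    ∀ x ∈ centraliser m e, m x x ∈ centraliser m e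

end Defs

section CommutativeDivision

variable {V : Type*} [NormedAddCommGroup V] [NormedSpace ℝ V]

lemma eq_or_eq_neg_of_square_eq (M : V →L[ℝ] V →L[ℝ] V) (hcomm : ∀ x y, M x y = M y x)
    (h0 : ∀ x y, M x y = 0 → x = 0 ∨ y = 0) {x y : V} (h : M x x = M y y) :
    x = y ∨ x = -y := by
  have : M (x - y) (x + y) = 0 := by
    simp only [map_sub, map_add, sub_apply]
    rw [h, hcomm x y]
    abel
  rcases h0 _ _ this with h | h
  · exact Or.inl (sub_eq_zero.1 h)
  · exact Or.inr (eq_neg_of_add_eq_zero_left h)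

variable [FiniteDimensional ℝ V]

/-- A continuous bilinear multiplication without isotropic vectors grows quadratically. -/
lemma exists_pos_mul_sq_norm_le (M : V →L[ℝ] V →L[ℝ] V) (h0 : ∀ x, M x x = 0 → x = 0) :
    ∃ c : ℝ, 0 < c ∧ ∀ x, c * ‖x‖ ^ 2 ≤ ‖M x x‖ := by
  have : ProperSpace V := FiniteDimensional.proper ℝ V
  rcases subsingleton_or_nontrivial V with hV | hV
  · exact ⟨1, one_pos, fun x => by simp [Subsingleton.elim x 0]⟩
  have hne : (Metric.sphere (0 : V) 1).Nonempty := NormedSpace.sphere_nonempty.2 zero_le_one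
  obtain ⟨y, hy, hmin⟩ := (isCompact_sphere (0 : V) 1).exists_isMinOn hne
    (f := fun x => ‖M x x‖) (by fun_prop)
  have hy1 : ‖y‖ = 1 := by simpa using hy
  refine ⟨‖M y y‖, ?_, fun x => ?_⟩
  · rw [norm_pos_iff]
    intro h
    simp [h0 y h] at hy1
  · rcases eq_or_ne x 0 with rfl | hx
    · simp
    have hx' : ‖x‖ ≠ 0 := norm_ne_zero_iff.2 hx
    have h1 : ‖x‖⁻¹ • x ∈ Metric.sphere (0 : V) 1 := by
      simp [norm_smul, hx']
    have h2 : ‖M y y‖ ≤ ‖M (‖x‖⁻¹ • x) (‖x‖⁻¹ • x)‖ := hmin h1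
    simp only [map_smul, smul_apply, norm_smul, norm_inv, norm_norm] at h2
    have hp : 0 < ‖x‖ := norm_pos_iff.2 hx
    calc ‖M y y‖ * ‖x‖ ^ 2 ≤ (‖x‖⁻¹ * (‖x‖⁻¹ * ‖M x x‖)) * ‖x‖ ^ 2 := by gcongr
      _ = ‖M x x‖ := by field_simp

lemma isClosedMap_square (M : V →L[ℝ] V →L[ℝ] V) (h0 : ∀ x, M x x = 0 → x = 0) :
    IsClosedMap fun x => M x x := by
  have : ProperSpace V := FiniteDimensional.proper ℝ V
  obtain ⟨c, hc, h⟩ := exists_pos_mul_sq_norm_le M h0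
  refine IsProperMap.isClosedMap (isProperMap_iff_tendsto_cocompact.2 ⟨by fun_prop, ?_⟩)
  rw [← Metric.cobounded_eq_cocompact, ← tendsto_norm_atTop_iff_cobounded]
  refine Filter.tendsto_atTop_mono h ?_
  exact ((Filter.tendsto_pow_atTop two_ne_zero).comp
    tendsto_norm_cobounded_atTop).const_mul_atTop hc

/-- In a commutative real division algebra, squaring is a covering of the nonzero vectors. -/
lemma isCoveringMapOn_square (M : V →L[ℝ] V →L[ℝ] V) (hcomm : ∀ x y, M x y = M y x)
    (h0 : ∀ x y, M x y = 0 → x = 0 ∨ y = 0) :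
    IsCoveringMapOn (fun x => M x x) {0}ᶜ := by
  have : CompleteSpace V := FiniteDimensional.complete ℝ V
  refine (isClosedMap_square M fun x hx => by simpa using h0 x x hx
    ).isCoveringMapOn_of_isLocalHomeomorphOn (fun a _ => ?_) fun a ha => ?_
  · rcases Set.eq_empty_or_nonempty ((fun x => M x x) ⁻¹' {a}) with h | ⟨y, hy⟩
    · rw [h]
      exact Set.finite_empty
    · refine (Set.toFinite {y, -y}).subset fun x hx => ?_
      exact eq_or_eq_neg_of_square_eq M hcomm h0 (hx.trans hy.symm)
  · have ha0 : a ≠ 0 := by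
      rintro rfl
      simp at ha
    have hinj : Function.Injective (((2 : ℝ) • M a : V →L[ℝ] V) : V →ₗ[ℝ] V) := by
      refine (injective_iff_map_eq_zero _).2 fun x hx => ?_
      have : M a x = 0 := by simpa using hx
      exact (h0 _ _ this).resolve_left ha0
    let E : V ≃L[ℝ] V := (LinearEquiv.ofInjectiveEndo _ hinj).toContinuousLinearEquiv
    have hd : HasStrictFDerivAt (fun x => M x x) (E : V →L[ℝ] V) a := by
      have h := M.hasStrictFDerivAt_of_bilinear (hasStrictFDerivAt_id (𝕜 := ℝ) a)
        (hasStrictFDerivAt_id (𝕜 := ℝ) a)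
      refine h.congr_fderiv ?_
      ext x
      simp [E, two_smul, hcomm x a]
    exact ⟨hd.toOpenPartialHomeomorph _, hd.mem_toOpenPartialHomeomorph_source, by simp⟩

lemma exists_half_angle {w : ℂ} (hw : ‖w‖ = 1) :
    ∃ t : ℝ, w.re = Real.cos t ^ 2 - Real.sin t ^ 2 ∧ w.im = 2 * Real.sin t * Real.cos t := by
  have h := Complex.norm_mul_cos_add_sin_mul_I w
  refine ⟨w.arg / 2, ?_, ?_⟩
  · rw [← Real.cos_two_mul', mul_div_cancel₀ _ two_ne_zero, Complex.cos_arg (by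
      rintro rfl; simp at hw), hw, div_one]
  · rw [← Real.sin_two_mul, mul_div_cancel₀ _ two_ne_zero, Complex.sin_arg, hw, div_one]

/-- **Hopf's theorem**: a commutative real division algebra has dimension at most two. -/
theorem finrank_le_two_of_commutative_division (M : V →L[ℝ] V →L[ℝ] V)
    (hcomm : ∀ x y, M x y = M y x) (h0 : ∀ x y, M x y = 0 → x = 0 ∨ y = 0) :
    finrank ℝ V ≤ 2 := by
  by_contra! hdim
  have cov := isCoveringMapOn_square M hcomm h0
  obtain ⟨b, hb⟩ := exists_linearIndependent_of_le_finrank (R := ℝ) (M := V) (n := 2) hdim.le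
  set x := b 0
  set y := b 1
  have hxy : ∀ s t : ℝ, s • x + t • y = 0 → s = 0 ∧ t = 0 :=
    by
    have hbe : b = ![x, y] := by
      ext i
      fin_cases i <;> rfl
    rw [hbe] at hb
    exact LinearIndependent.pair_iff.1 hb
  let γ : ℝ → V := fun t => Real.cos t • x + Real.sin t • y
  have hγ0 : ∀ t, γ t ≠ 0 := fun t h => by
    have := hxy _ _ h
    have h1 := Real.cos_sq_add_sin_sq t
    simp [this.1, this.2] at h1
  have hγsq0 : ∀ t, M (γ t) (γ t) ≠ 0 := fun t h => hγ0 t (by simpa using h0 _ _ h)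
  let u : V := (1 / 2 : ℝ) • (M x x - M y y)
  let v : V := M x y
  let c : V := (1 / 2 : ℝ) • (M x x + M y y)
  let W : Submodule ℝ V := Submodule.span ℝ (Set.range ![u, v])
  have hu : u ∈ W := Submodule.subset_span (by simp)
  have hv : v ∈ W := Submodule.subset_span (by simp)
  have hγsq : ∀ t, M (γ t) (γ t) =
      c + (Real.cos t ^ 2 - Real.sin t ^ 2) • u + (2 * Real.sin t * Real.cos t) • v := fun t => by
    have h1 : Real.sin t ^ 2 = 1 - Real.cos t ^ 2 := Real.sin_sq t
    simp only [γ, c, u, v, map_add, map_smul, add_apply,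
      smul_apply, hcomm y x]
    match_scalars
    · linear_combination (1 / 2) * h1
    · ring
    · linear_combination (1 / 2) * h1
  -- an apex from which the loop of squares can be coned off away from zero
  obtain ⟨p, hp⟩ : ∃ p : V, ∀ r : ℝ, (1 - r) • p + r • c ∈ W → r = 1 ∧ c ∈ W := by
    by_cases hc : c ∈ W
    · have hW : W ≠ ⊤ := fun h => by
        have h1 : finrank ℝ W ≤ 2 := finrank_range_le_card ![u, v]
        rw [h, finrank_top] at h1
        omega
      obtain ⟨p, hp⟩ : ∃ p, p ∉ W := by
        by_contra! h
        exact hW (Submodule.eq_top_iff'.2 h)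
      refine ⟨p, fun r hr => ⟨?_, hc⟩⟩
      have h1 : (1 - r) • p ∈ W := (Submodule.add_mem_iff_left _ (W.smul_mem r hc)).1 hr
      by_contra hne
      exact hp ((Submodule.smul_mem_iff _ (sub_ne_zero.2 (Ne.symm hne))).1 h1)
    · refine ⟨c, fun r hr => absurd ?_ hc⟩
      simpa [← add_smul] using hr
  let ρ : ℂ → ℂ := fun z => ((max 1 ‖z‖)⁻¹ : ℝ) • z
  have hρcont : Continuous ρ := by
    have h : Continuous fun z : ℂ => max 1 ‖z‖ := by fun_prop
    exact (h.inv₀ fun z => by positivity).smul continuous_id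
  have hρ1 : ∀ z : ℂ, ‖z‖ = 1 → ρ z = z := fun z hz => by simp [ρ, hz]
  let g : ℂ → V := fun w => (1 - ‖w‖) • p + ‖w‖ • c + w.re • u + w.im • v
  have hgcirc : ∀ (w : ℂ) (t : ℝ), ‖w‖ = 1 → w.re = Real.cos t ^ 2 - Real.sin t ^ 2 →
      w.im = 2 * Real.sin t * Real.cos t → g w = M (γ t) (γ t) := fun w t h1 h2 h3 => by
    rw [hγsq]
    simp [g, h1, h2, h3]
  have hg0 : ∀ w, g w ≠ 0 := fun w h => by
    have hmem : (1 - ‖w‖) • p + ‖w‖ • c ∈ W := by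
      have : (1 - ‖w‖) • p + ‖w‖ • c = -(w.re • u + w.im • v) := by
        rw [eq_neg_iff_add_eq_zero, ← add_assoc]
        exact h
      rw [this]
      exact W.neg_mem (W.add_mem (W.smul_mem _ hu) (W.smul_mem _ hv))
    have h1 := (hp _ hmem).1
    obtain ⟨t, ht1, ht2⟩ := exists_half_angle h1
    exact hγsq0 t (by rw [← hgcirc w t h1 ht1 ht2, h])
  have hgcont : Continuous g := by fun_prop
  have hγcont : Continuous γ := by fun_prop
  have hγzero : γ 0 = x := by simp [γ]
  let f : C(ℂ, V) := ⟨g ∘ ρ, hgcont.comp hρcont⟩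
  have hcirc : ∀ t : ℝ, f (Complex.exp ((2 * t : ℝ) * Complex.I)) = M (γ t) (γ t) := fun t => by
    have h1 := Complex.norm_exp_ofReal_mul_I (2 * t)
    change g (ρ _) = _
    rw [hρ1 _ h1]
    exact hgcirc _ _ h1 (by rw [Complex.exp_ofReal_mul_I_re, Real.cos_two_mul'])
      (by rw [Complex.exp_ofReal_mul_I_im, Real.sin_two_mul])
  obtain ⟨σ, ⟨hσ1, hσ⟩, -⟩ := cov.existsUnique_continuousMap_lifts f (a₀ := 1) (e₀ := x)
    (by simpa [hγzero] using (hcirc 0).symm) (fun z => hg0 _)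
  let sq : C(ℝ, V) := ⟨fun t => M (γ t) (γ t), by fun_prop⟩
  let γ₁ : C(ℝ, V) := ⟨γ, hγcont⟩
  let γ₂ : C(ℝ, V) := ⟨fun t => σ (Complex.exp ((2 * t : ℝ) * Complex.I)), by fun_prop⟩
  have heq : γ₁ = γ₂ := (cov.existsUnique_continuousMap_lifts sq (a₀ := 0) (e₀ := x)
    (by simp [sq, hγzero]) hγsq0).unique ⟨hγzero, rfl⟩
    ⟨by simpa [γ₂] using hσ1, funext fun t => (congrFun hσ _).trans (hcirc t)⟩
  have hpi : γ Real.pi = σ (Complex.exp ((2 * Real.pi : ℝ) * Complex.I)) :=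
    DFunLike.congr_fun heq Real.pi
  have hx : -x = x := by
    simpa [γ, Complex.exp_two_pi_mul_I, hσ1] using hpi
  have := hxy 2 0 (by
    rw [zero_smul, add_zero, two_smul]
    nth_rewrite 1 [← hx]
    exact neg_add_cancel x)
  exact two_ne_zero this.1

end CommutativeDivision

section Isotope

variable {A : Type*} [AddCommGroup A] [Module ℝ A] {m : A →ₗ[ℝ] A →ₗ[ℝ] A}

lemma IsDivision.eq_zero_or_eq_zero (hdiv : IsDivision m) {x y : A} (h : m x y = 0) :
    x = 0 ∨ y = 0 := by
  by_contra! hxy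
  exact hxy.2 ((hdiv x hxy.1).1.injective (by simpa using h))

lemma isSubalg_genSubalg (s : Set A) : IsSubalg m (genSubalg m s) := by
  intro x hx y hy
  simp only [genSubalg, Submodule.mem_sInf] at *
  exact fun U hU => hU.1 x (hx U hU) y (hy U hU)

lemma subset_genSubalg (s : Set A) : s ⊆ (genSubalg m s : Set A) := by
  intro x hx
  simp only [genSubalg, SetLike.mem_coe, Submodule.mem_sInf]
  exact fun U hU => hU.2 hx

lemma mem_genSubalg_self (x : A) : x ∈ genSubalg m {x} :=
  subset_genSubalg _ rfl

lemma isotope_apply (m : A →ₗ[ℝ] A →ₗ[ℝ] A) (T : A →ₗ[ℝ] A) (x y : A) :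
    isotope m T x y = m (T x) (T y) := rfl

lemma IsDivision.isotope (hdiv : IsDivision m) {T : A →ₗ[ℝ] A} (hT : Function.Bijective T) :
    IsDivision (isotope m T) := fun a ha => by
  have ha' : T a ≠ 0 := fun h => ha (hT.injective (by simpa using h))
  exact ⟨(hdiv _ ha').1.comp hT, (hdiv _ ha').2.comp hT⟩

variable [FiniteDimensional ℝ A]

lemma IsDivision.finrank_le_two (hdiv : IsDivision m) {U : Submodule ℝ A} (hU : IsSubalg m U)
    (hcomm : ∀ a ∈ U, ∀ b ∈ U, m a b = m b a) : finrank ℝ U ≤ 2 := by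
  let φ : U ≃ₗ[ℝ] EuclideanSpace ℝ (Fin (finrank ℝ U)) :=
    LinearEquiv.ofFinrankEq _ _ (by simp)
  let i : EuclideanSpace ℝ (Fin (finrank ℝ U)) →ₗ[ℝ] A := U.subtype ∘ₗ φ.symm.toLinearMap
  have hi : ∀ a, i a = 0 → a = 0 := fun a ha => by simpa [i] using ha
  have hmem : ∀ a, i a ∈ U := fun a => (φ.symm a).2
  let N : EuclideanSpace ℝ (Fin (finrank ℝ U)) →ₗ[ℝ] EuclideanSpace ℝ (Fin (finrank ℝ U)) →ₗ[ℝ]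
      EuclideanSpace ℝ (Fin (finrank ℝ U)) :=
    LinearMap.mk₂ ℝ (fun a b => φ ⟨m (i a) (i b), hU _ (hmem a) _ (hmem b)⟩)
      (fun a a' b => by rw [← map_add]; congr 1; ext; simp)
      (fun r a b => by rw [← map_smul]; congr 1; ext; simp)
      (fun a b b' => by rw [← map_add]; congr 1; ext; simp)
      (fun r a b => by rw [← map_smul]; congr 1; ext; simp)
  have h := finrank_le_two_of_commutative_division N.toContinuousBilinearMap
    (fun a b => by
      change φ _ = φ _
      congr 2
      exact hcomm _ (hmem a) _ (hmem b))
    (fun a b hab => by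
      have h1 : φ ⟨m (i a) (i b), hU _ (hmem a) _ (hmem b)⟩ = 0 := hab
      have h2 : m (i a) (i b) = 0 := by simpa using h1
      exact (hdiv.eq_zero_or_eq_zero h2).imp (hi a) (hi b))
  simpa using h

/-- A single element either squares to a multiple of itself, or generates a subalgebra
containing every omnipresent idempotent. -/
lemma Omnipresent.mem_genSubalg_or_square_eq_smul {e : A} (he : Omnipresent m e)
    (hdiv : IsDivision m) (hpc : PowerComm m) (x : A) :
    e ∈ genSubalg m {x} ∨ ∃ r : ℝ, m x x = r • x := by
  have hx : x ∈ genSubalg m {x} := mem_genSubalg_self x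
  rcases (hdiv.finrank_le_two (isSubalg_genSubalg {x}) (hpc x)).eq_or_lt with h | h
  · exact Or.inl (he.2.2 _ (isSubalg_genSubalg _) h)
  · right
    rcases eq_or_ne x 0 with rfl | hx0
    · exact ⟨0, by simp⟩
    obtain ⟨w, hw⟩ := finrank_le_one_iff.1 (Nat.le_of_lt_succ h)
    obtain ⟨s, hs⟩ := hw ⟨x, hx⟩
    obtain ⟨t, ht⟩ := hw ⟨m x x, isSubalg_genSubalg _ x hx x hx⟩
    have hs' : s • (w : A) = x := congrArg Subtype.val hs
    have ht' : t • (w : A) = m x x := congrArg Subtype.val ht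
    have hs0 : s ≠ 0 := by
      rintro rfl
      exact hx0 (by simpa using hs'.symm)
    exact ⟨t / s, by rw [← ht', div_eq_mul_inv, mul_smul, (inv_smul_eq_iff₀ hs0).2 hs'.symm]⟩

/-- Every element lies with the omnipresent idempotent in a common commutative
subalgebra of dimension at most two. -/
lemma Omnipresent.exists_isSubalg {e : A} (he : Omnipresent m e)
    (hdiv : IsDivision m) (hpc : PowerComm m) (y : A) :
    ∃ U : Submodule ℝ A, IsSubalg m U ∧ (∀ a ∈ U, ∀ b ∈ U, m a b = m b a) ∧
      finrank ℝ U ≤ 2 ∧ e ∈ U ∧ y ∈ U := by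
  have key : ∀ x, e ∈ genSubalg m {x} → y ∈ genSubalg m {x} →
      ∃ U : Submodule ℝ A, IsSubalg m U ∧ (∀ a ∈ U, ∀ b ∈ U, m a b = m b a) ∧
      finrank ℝ U ≤ 2 ∧ e ∈ U ∧ y ∈ U := fun x h1 h2 =>
    ⟨_, isSubalg_genSubalg {x}, hpc x,
      hdiv.finrank_le_two (isSubalg_genSubalg {x}) (hpc x), h1, h2⟩
  have hee : m e e = e := he.2.1
  by_cases hye : ∃ r : ℝ, y = r • e
  · obtain ⟨r, rfl⟩ := hye
    exact key e (mem_genSubalg_self e) (Submodule.smul_mem _ r (mem_genSubalg_self e))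
  rcases he.mem_genSubalg_or_square_eq_smul hdiv hpc y with h | ⟨l, hl⟩
  · exact key y h (mem_genSubalg_self y)
  have hy0 : y ≠ 0 := fun h => hye ⟨0, by simp [h]⟩
  have hl0 : l ≠ 0 := by
    rintro rfl
    rw [zero_smul] at hl
    exact hy0 (by simpa using hdiv.eq_zero_or_eq_zero hl)
  set f := l⁻¹ • y with hf
  have hyf : y = l • f := by rw [hf, smul_inv_smul₀ hl0]
  have hff : m f f = f := by
    simp [hf, hl, hl0]
  have hind : ∀ s t : ℝ, s • e + t • f = 0 → s = 0 ∧ t = 0 := fun s t h => by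
    have ht : t = 0 := by
      by_contra ht
      apply hye
      refine ⟨l * (-(t⁻¹ * s)), ?_⟩
      have h1 : t • f = -(s • e) := eq_neg_of_add_eq_zero_right h
      rw [hyf, mul_smul, neg_smul, mul_smul, ← smul_neg, ← h1, inv_smul_smul₀ ht]
    refine ⟨?_, ht⟩
    rw [ht, zero_smul, add_zero] at h
    exact (smul_eq_zero.1 h).resolve_right he.1
  rcases he.mem_genSubalg_or_square_eq_smul hdiv hpc (e + f) with h | ⟨r, hr⟩
  · refine key (e + f) h ?_
    rw [hyf]
    refine Submodule.smul_mem _ l ?_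
    simpa using Submodule.sub_mem _ (mem_genSubalg_self (m := m) (e + f)) h
  rcases he.mem_genSubalg_or_square_eq_smul hdiv hpc (e - f) with h | ⟨s, hs⟩
  · refine key (e - f) h ?_
    rw [hyf]
    refine Submodule.smul_mem _ l ?_
    simpa using Submodule.sub_mem _ h (mem_genSubalg_self (m := m) (e - f))
  exfalso
  have hsum : m (e + f) (e + f) + m (e - f) (e - f) = (2 : ℝ) • (e + f) := by
    simp only [map_add, map_sub, LinearMap.add_apply, LinearMap.sub_apply, hee, hff]
    module
  rw [hr, hs] at hsum
  obtain ⟨h1, h2⟩ := hind (r + s - 2) (r - s - 2) (by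
    rw [← sub_eq_zero] at hsum
    rw [← hsum]
    module)
  have hs0 : s = 0 := by linarith
  rw [hs0, zero_smul] at hs
  have hef : e - f = 0 := by simpa using hdiv.eq_zero_or_eq_zero hs
  have := (hind 1 (-1) (by rw [← hef]; module)).1
  exact one_ne_zero this

end Isotope

/-- For an omnipresent idempotent `e` with inverse `S` of the left
multiplication `L_e`, the isotope `A_{L_e⁻¹}` with multiplication
`x ∘ y = (S x)·(S y)` is a quadratic division algebra with identity element `e`. -/
theorem stmt_10 {A : Type*} [AddCommGroup A] [Module ℝ A] [FiniteDimensional ℝ A]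
    (m : A →ₗ[ℝ] A →ₗ[ℝ] A) (hdiv : IsDivision m) (hpc : PowerComm m)
    (e : A) (he : Omnipresent m e)
    (S : A →ₗ[ℝ] A) (hS : ∀ x : A, m e (S x) = x) (hS' : ∀ x : A, S (m e x) = x) :
    IsDivision (isotope m S) ∧ IsQuadraticWith (isotope m S) e := by
  have hSe : S e = e := by simpa [he.2.1] using hS' e
  refine ⟨hdiv.isotope ⟨fun x y h => ?_, fun x => ⟨m e x, hS' x⟩⟩, fun x => ⟨?_, ?_⟩, fun x hli => ?_⟩
  · rw [← hS x, h, hS y]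
  · rw [isotope_apply, hSe, hS]
  · obtain ⟨U, -, hcomm, -, heU, hxU⟩ := he.exists_isSubalg hdiv hpc (S x)
    rw [isotope_apply, hSe, hcomm _ hxU _ heU, hS]
  · obtain ⟨U, hU, -, hdim, heU, hxU⟩ := he.exists_isSubalg hdiv hpc (S x)
    have hx : x ∈ U := by simpa [hS] using hU _ heU _ hxU
    have hspan : Submodule.span ℝ (Set.range ![e, x, isotope m S x x]) ≤ U := by
      rw [Submodule.span_le]
      rintro _ ⟨i, rfl⟩
      fin_cases i
      exacts [heU, hx, hU _ hxU _ hxU]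
    have h1 := Submodule.finrank_mono hspan
    rw [finrank_span_eq_card hli, Fintype.card_fin] at h1
    omega
end

section
/- Let A and B be quadratic real division algebras of dimension at least four, and let S : A → A and T : B → B be planar maps. Then a nonzero linear map φ : A → B is multiplicative with respect to the isotope multiplications of A_S and B_T (i.e. φ((Sx)(Sy)) = (Tφx)(Tφy) for all x, y) if and only if φ is multiplicative A → B (φ(xy) = φ(x)φ(y) for all x, y) and φ ∘ S = T ∘ φ. -/
open Module

section QuadraticDivision

variable {B : Type*} [AddCommGroup B] [Module ℝ B]
  {m : B →ₗ[ℝ] B →ₗ[ℝ] B} {one : B}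

/-- In a division algebra there are no zero divisors. -/
lemma IsDivision.eq_zero_of_mul_eq_zero (hd : IsDivision m) {a b : B} (ha : a ≠ 0)
    (h : m a b = 0) : b = 0 :=
  (hd a ha).1.1 (by simpa using h)

/-- The square of a non-scalar element of a quadratic algebra is a combination of the
identity and the element. -/
lemma IsQuadraticWith.exists_mul_self_eq (hq : IsQuadraticWith m one) {x : B}
    (hx : ∀ c : ℝ, x ≠ c • one) : ∃ c d : ℝ, m x x = c • one + d • x := by
  obtain ⟨g, hg, i, hi⟩ := Fintype.not_linearIndependent_iff.1 (hq.2 x)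
  simp only [Fin.sum_univ_three, Matrix.cons_val_zero, Matrix.cons_val_one,
    Matrix.cons_val] at hg
  by_cases h2 : g 2 = 0
  · exfalso
    by_cases h1 : g 1 = 0
    · have h0 : g 0 ≠ 0 := by
        intro h0
        fin_cases i <;> simp_all
      have hone : one = 0 := by simpa [h1, h2, h0] using hg
      apply hx 0
      rw [← (hq.1 x).1, hone]
      simp
    · apply hx (-(g 0 / g 1))
      have : g 1 • x = g 1 • (-(g 0 / g 1)) • one := by
        rw [smul_smul, show g 1 * -(g 0 / g 1) = -g 0 by field_simp]
        rw [h2] at hg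
        linear_combination (norm := module) hg
      exact smul_right_injective B h1 this
  · refine ⟨-(g 0 / g 2), -(g 1 / g 2), smul_right_injective B h2 ?_⟩
    simp only [smul_add, smul_smul]
    rw [show g 2 * -(g 0 / g 2) = -g 0 by field_simp,
      show g 2 * -(g 1 / g 2) = -g 1 by field_simp]
    linear_combination (norm := module) hg

/-- A non-scalar element can be shifted by a scalar so that its square is scalar. -/
lemma IsQuadraticWith.exists_mul_self_sub_smul_eq (hq : IsQuadraticWith m one) {x : B}
    (hx : ∀ c : ℝ, x ≠ c • one) :
    ∃ t p : ℝ, m (x - t • one) (x - t • one) = p • one := by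
  obtain ⟨c, d, h⟩ := hq.exists_mul_self_eq hx
  refine ⟨d / 2, c + d ^ 2 / 4, ?_⟩
  simp only [map_sub, map_smul, LinearMap.sub_apply, LinearMap.smul_apply, (hq.1 _).1,
    (hq.1 _).2, h]
  module

/-- In a quadratic division algebra, everything that commutes with a non-scalar element `a`
lies in the plane spanned by the identity and `a`. -/
lemma IsQuadraticWith.mem_span_pair_of_commute (hq : IsQuadraticWith m one)
    (hd : IsDivision m) {a y : B} (ha : ∀ c : ℝ, a ≠ c • one) (hay : m a y = m y a) :
    y ∈ Submodule.span ℝ {one, a} := by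
  by_contra hy
  have hy' : ∀ c d : ℝ, y ≠ c • one + d • a := fun c d h =>
    hy (Submodule.mem_span_pair.2 ⟨c, d, h.symm⟩)
  obtain ⟨t, p, hu⟩ := hq.exists_mul_self_sub_smul_eq ha
  obtain ⟨s, r, hv⟩ := hq.exists_mul_self_sub_smul_eq (x := y)
    (fun c h => hy' c 0 (by simpa using h))
  set u := a - t • one with hu_def
  set v := y - s • one with hv_def
  have huv : m v u = m u v := by
    simp only [hu_def, hv_def, map_sub, map_smul, LinearMap.sub_apply, LinearMap.smul_apply,
      (hq.1 _).1, (hq.1 _).2, hay]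
    module
  have hind_u : ∀ c d : ℝ, d • u = c • one → d = 0 := by
    intro c d h
    by_contra hd0
    apply ha (t + d⁻¹ * c)
    have : u = d⁻¹ • c • one := by rw [← h, smul_smul, inv_mul_cancel₀ hd0, one_smul]
    rw [add_smul, mul_smul, ← this, hu_def]
    abel
  have hind_v : ∀ c d e : ℝ, d • u + e • v = c • one → d = 0 ∧ e = 0 := by
    intro c d e h
    have he : e = 0 := by
      by_contra he
      apply hy' (s + e⁻¹ * (c + d * t)) (-(e⁻¹ * d))
      have : v = e⁻¹ • (c • one - d • u) := by
        rw [← h, add_sub_cancel_left, smul_smul, inv_mul_cancel₀ he, one_smul]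
      have hyv : y = v + s • one := by rw [hv_def]; abel
      rw [hyv, this, hu_def]
      module
    refine ⟨hind_u c d ?_, he⟩
    simpa [he] using h
  have hne_add : ∀ c : ℝ, u + v ≠ c • one := fun c h =>
    one_ne_zero (hind_v c 1 1 (by simpa using h)).1
  have hne_sub : ∀ c : ℝ, u - v ≠ c • one := fun c h =>
    one_ne_zero (hind_v c 1 (-1) (by rw [← h]; module)).1
  obtain ⟨c₁, d₁, h₁⟩ := hq.exists_mul_self_eq hne_add
  obtain ⟨c₂, d₂, h₂⟩ := hq.exists_mul_self_eq hne_sub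
  simp only [map_add, map_sub, LinearMap.add_apply, LinearMap.sub_apply, hu, hv, huv] at h₁ h₂
  obtain ⟨hsum, hdiff⟩ := hind_v (2 * p + 2 * r - c₁ - c₂) (d₁ + d₂) (d₁ - d₂) (by
    linear_combination (norm := module) -h₁ - h₂)
  have hd₁ : d₁ = 0 := by linarith
  have hprod : m u v = ((c₁ - p - r) / 2) • one := by
    rw [hd₁] at h₁
    linear_combination (norm := module) (1 / 2 : ℝ) • h₁
  have hu0 : u ≠ 0 := fun h => one_ne_zero (hind_u 0 1 (by simp [h]))
  have hp : p ≠ 0 := by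
    rintro rfl
    exact hu0 (hd.eq_zero_of_mul_eq_zero hu0 (by simpa using hu))
  have hzero : v - ((c₁ - p - r) / 2 / p) • u = 0 := by
    refine hd.eq_zero_of_mul_eq_zero hu0 ?_
    rw [map_sub, map_smul, hprod, hu, smul_smul, div_mul_cancel₀ _ hp, sub_self]
  exact one_ne_zero (hind_v 0 (-((c₁ - p - r) / 2 / p)) 1 (by
    rw [zero_smul, ← hzero]; module)).2

/-- In a quadratic division algebra, an element commuting with a subspace of dimension at
least three is a scalar multiple of the identity. -/
lemma IsQuadraticWith.exists_eq_smul_of_commute [FiniteDimensional ℝ B]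
    (hq : IsQuadraticWith m one) (hd : IsDivision m) {a : B} (U : Submodule ℝ B)
    (hU : 3 ≤ Module.finrank ℝ U) (hcomm : ∀ y ∈ U, m a y = m y a) :
    ∃ c : ℝ, a = c • one := by
  by_contra! ha
  have hle : U ≤ Submodule.span ℝ (Set.range ![one, a]) := fun y hy => by
    simpa [Set.pair_comm] using hq.mem_span_pair_of_commute hd ha (hcomm y hy)
  have h₁ := Submodule.finrank_mono hle
  have h₂ : Module.finrank ℝ (Submodule.span ℝ (Set.range ![one, a])) ≤ 2 := by
    simpa [Set.finrank] using finrank_range_le_card (R := ℝ) ![one, a]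
  omega

end QuadraticDivision

/-- For quadratic real division algebras `A`, `B` of dimension ≥ 4 with
planar maps `S`, `T`, a nonzero linear map `φ : A → B` is multiplicative for the
isotope multiplications iff it is multiplicative `A → B` and `φ ∘ S = T ∘ φ`. -/
theorem stmt_14 {A B : Type*}
    [AddCommGroup A] [Module ℝ A] [FiniteDimensional ℝ A]
    [AddCommGroup B] [Module ℝ B] [FiniteDimensional ℝ B]
    (mA : A →ₗ[ℝ] A →ₗ[ℝ] A) (mB : B →ₗ[ℝ] B →ₗ[ℝ] B)
    (hdivA : IsDivision mA) (hdivB : IsDivision mB)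
    (oneA : A) (hqA : IsQuadraticWith mA oneA)
    (oneB : B) (hqB : IsQuadraticWith mB oneB)
    (hdimA : 4 ≤ Module.finrank ℝ A) (hdimB : 4 ≤ Module.finrank ℝ B)
    (S : A →ₗ[ℝ] A) (hS : Planar mA oneA S)
    (T : B →ₗ[ℝ] B) (hT : Planar mB oneB T)
    (φ : A →ₗ[ℝ] B) (hφ : φ ≠ 0) :
    (∀ x y : A, φ (mA (S x) (S y)) = mB (T (φ x)) (T (φ y))) ↔
      ((∀ x y : A, φ (mA x y) = mB (φ x) (φ y)) ∧ ∀ x : A, φ (S x) = T (φ x)) := by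
  constructor
  · intro h
    have hker : ∀ x, φ x = 0 → x = 0 := by
      intro x hx
      by_contra hx0
      apply hφ
      ext z
      have hSx : S x ≠ 0 := fun h0 => hx0 (hS.1.1 (by rw [h0, map_zero]))
      obtain ⟨w, hw⟩ := (hdivA (S x) hSx).1.2 z
      obtain ⟨y, rfl⟩ := hS.1.2 w
      rw [← hw]
      simp [h, hx]
    have hφinj : Function.Injective φ := (injective_iff_map_eq_zero φ).2 hker
    have hl : ∀ x, φ (S x) = mB (T (φ oneA)) (T (φ x)) := fun x => by
      rw [← h, hS.2.1, (hqA.1 _).1]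
    have hr : ∀ x, φ (S x) = mB (T (φ x)) (T (φ oneA)) := fun x => by
      rw [← h, hS.2.1, (hqA.1 _).2]
    obtain ⟨c, hc⟩ := hqB.exists_eq_smul_of_commute hdivB (a := T (φ oneA))
      (LinearMap.range (T ∘ₗ φ))
      (by
        rw [LinearMap.finrank_range_of_inj (f := T ∘ₗ φ) (hT.1.1.comp hφinj)]
        omega)
      (by
        rintro _ ⟨x, rfl⟩
        exact (hl x).symm.trans (hr x))
    have he : φ oneA = c • oneB := hT.1.1 (by rw [hc, map_smul, hT.2.1])
    have hsq := hl oneA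
    rw [hS.2.1, hc, he, map_smul, map_smul, LinearMap.smul_apply, (hqB.1 _).1] at hsq
    have hne : φ oneA ≠ 0 := fun h0 => by
      apply hφ
      ext z
      have h1 := hker _ h0
      rw [← (hqA.1 z).1, h1]
      simp
    have hone : T (φ oneA) = oneB := by
      have hc0 : c ≠ 0 := by
        rintro rfl
        exact hne (by simpa using he)
      rw [hc]
      exact (smul_right_injective B hc0 hsq).symm
    have hint : ∀ x, φ (S x) = T (φ x) := fun x => by rw [hl, hone, (hqB.1 _).1]
    refine ⟨fun x y => ?_, hint⟩
    obtain ⟨x, rfl⟩ := hS.1.2 x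
    obtain ⟨y, rfl⟩ := hS.1.2 y
    rw [h, hint, hint]
  · rintro ⟨hmul, hint⟩ x y
    rw [hmul, hint, hint]
end
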